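/- Allocation lower bound for 1-uniform safe strategies, part 1: let b* be an m-uniform strategy that satisfies the RoI constraint against a competing-bid profile β₋, and let r = x(b*;β₋). Then for every q with 1 ≤ q ≤ r, the 1-uniform strategy (w_q, q) bidding w_q on q units is allocated exactly q units against β₋: x((w_q,q);β₋) = q. -/

import Mathlib

open Finset

namespace Auction

/-- A competing-bid profile for an auction of `K` identical units, represented by the
function sending `j ∈ {1,…,K}` to the `j`-th smallest element of the multiset of the
`K` largest competing bids. -/
structure Profile (K : ℕ) where
  c : ℕ → ℝ
  mono : ∀ i j : ℕ, 1 ≤ i → i ≤ j → j ≤ K → c i ≤ c j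
  nonneg : ∀ j : ℕ, 1 ≤ j → j ≤ K → 0 ≤ c j

/-- A bid vector: `n` units are demanded and `bid j` is the bid for the `j`-th unit
(for `1 ≤ j ≤ n`). -/
structure BidVec where
  n : ℕ
  bid : ℕ → ℝ

/-- A bid vector is valid if its bids are non-increasing and positive. -/
def BidVec.Valid (b : BidVec) : Prop :=
  (∀ i j : ℕ, 1 ≤ i → i ≤ j → j ≤ b.n → b.bid j ≤ b.bid i) ∧
  ∀ j : ℕ, 1 ≤ j → j ≤ b.n → 0 < b.bid j

open Classical in
/-- The number of units the bidder wins (ties broken in the bidder's favor): the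
largest `r ≤ min n K` such that the bidder's `j`-th bid is at least the `j`-th
threshold `β.c j` for every `j ≤ r`. -/
noncomputable def alloc (K : ℕ) (b : BidVec) (β : Profile K) : ℕ :=
  ((Finset.Icc 1 (min b.n K)).filter fun r => ∀ j ∈ Finset.Icc 1 r, β.c j ≤ b.bid j).sup id

/-- The clearing price: the `K`-th highest among all submitted bids (taken to be `0`
when the bidder wins no unit). -/
noncomputable def price (K : ℕ) (b : BidVec) (β : Profile K) : ℝ :=
  if alloc K b β = 0 then 0
  else if alloc K b β < K then min (b.bid (alloc K b β)) (β.c (alloc K b β + 1))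
  else b.bid K

/-- The value obtained by the bidder. -/
noncomputable def value (v : ℕ → ℝ) (K : ℕ) (b : BidVec) (β : Profile K) : ℝ :=
  ∑ j ∈ Finset.Icc 1 (alloc K b β), v j

/-- The bidder's total payment. -/
noncomputable def payment (K : ℕ) (b : BidVec) (β : Profile K) : ℝ :=
  price K b β * (alloc K b β : ℝ)

/-- The RoI constraint (with target RoI `γ = 0`) against a single competing-bid profile. -/
def Feasible (v : ℕ → ℝ) (K : ℕ) (b : BidVec) (β : Profile K) : Prop :=
  payment K b β ≤ value v K b β

/-- A bid vector is safe if it satisfies the RoI constraint against every profile. -/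
def Safe (v : ℕ → ℝ) (K : ℕ) (b : BidVec) : Prop :=
  ∀ β : Profile K, Feasible v K b β

/-- A valuation vector: nonnegative and non-increasing on `{1,…,M}`. -/
def ValidValuation (M : ℕ) (v : ℕ → ℝ) : Prop :=
  (∀ j : ℕ, 1 ≤ j → j ≤ M → 0 ≤ v j) ∧
  ∀ i j : ℕ, 1 ≤ i → i ≤ j → j ≤ M → v j ≤ v i

/-- The average cumulative valuation `w_j = (v_1 + ⋯ + v_j) / j`. -/
noncomputable def w (v : ℕ → ℝ) (j : ℕ) : ℝ :=
  (∑ ℓ ∈ Finset.Icc 1 j, v ℓ) / (j : ℝ)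

/-- An `m`-uniform bidding strategy: bid-quantity pairs `(b j, q j)` for `1 ≤ j ≤ m`. -/
structure Uniform where
  m : ℕ
  b : ℕ → ℝ
  q : ℕ → ℕ

/-- Cumulative quantities `Q j = q 1 + ⋯ + q j`. -/
def Uniform.Q (s : Uniform) (j : ℕ) : ℕ := ∑ ℓ ∈ Finset.Icc 1 j, s.q ℓ

/-- `s` is a genuine `m`-uniform strategy for maximum demand `M`:
`b 1 > b 2 > ⋯ > b m > 0`, positive quantities, and `Q m ≤ M`. -/
def Uniform.IsUniform (M : ℕ) (s : Uniform) : Prop :=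
  1 ≤ s.m ∧
  (∀ j : ℕ, 1 ≤ j → j ≤ s.m → 0 < s.q j) ∧
  0 < s.b s.m ∧
  (∀ j : ℕ, 1 ≤ j → j < s.m → s.b (j + 1) < s.b j) ∧
  s.Q s.m ≤ M

/-- The bid vector associated to a uniform strategy: the bid on the `j`-th unit is
`b ℓ`, where `ℓ` is least with `j ≤ Q ℓ`. -/
noncomputable def Uniform.toBidVec (s : Uniform) : BidVec :=
  ⟨s.Q s.m, fun j => s.b (sInf {ℓ : ℕ | j ≤ s.Q ℓ})⟩

/-- The 1-uniform strategy bidding `b` on `q` units. -/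
def single (b : ℝ) (q : ℕ) : Uniform := ⟨1, fun _ => b, fun _ => q⟩

/-- Membership in the class `𝒫*_{≤ m}` of safe undominated strategies with at most `m`
bid-quantity pairs: strategies determined by a tuple `0 < Q 1 < ⋯ < Q k ≤ M` (`k ≤ m`)
via `b ℓ = w (Q ℓ)` and `q ℓ = Q ℓ - Q (ℓ-1)`. -/
def InSafeClass (M : ℕ) (v : ℕ → ℝ) (m : ℕ) (s : Uniform) : Prop :=
  1 ≤ s.m ∧ s.m ≤ m ∧ (∀ j : ℕ, 1 ≤ j → j ≤ s.m → 0 < s.q j) ∧ s.Q s.m ≤ M ∧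
  ∀ ℓ : ℕ, 1 ≤ ℓ → ℓ ≤ s.m → s.b ℓ = w v (s.Q ℓ)

/-- Membership in the class `𝒬_{≤ m}(H)` of strategies with at most `m` bid-quantity
pairs that are RoI-feasible for the bid history `H` over rounds `1,…,T`. -/
def InFeasClass (M : ℕ) (v : ℕ → ℝ) (K T : ℕ) (H : ℕ → Profile K) (m : ℕ) (s : Uniform) : Prop :=
  s.IsUniform M ∧ s.m ≤ m ∧ ∀ t ∈ Finset.Icc 1 T, Feasible v K s.toBidVec (H t)

/-- Total value obtained by strategy `s` over the bid history `H` on rounds `1,…,T`. -/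
noncomputable def totalValue (v : ℕ → ℝ) (K T : ℕ) (H : ℕ → Profile K) (s : Uniform) : ℝ :=
  ∑ t ∈ Finset.Icc 1 T, value v K s.toBidVec (H t)

/-- The optimal total value over the class `𝒫*_{≤ m}`. -/
noncomputable def bestSafe (M : ℕ) (v : ℕ → ℝ) (K T : ℕ) (H : ℕ → Profile K) (m : ℕ) : ℝ :=
  sSup {x : ℝ | ∃ s : Uniform, InSafeClass M v m s ∧ x = totalValue v K T H s}

/-- The optimal total value over the class `𝒬_{≤ m}(H)`. -/
noncomputable def bestFeas (M : ℕ) (v : ℕ → ℝ) (K T : ℕ) (H : ℕ → Profile K) (m : ℕ) : ℝ :=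
  sSup {x : ℝ | ∃ s : Uniform, InFeasClass M v K T H m s ∧ x = totalValue v K T H s}

theorem le_alloc_iff {K : ℕ} {b : BidVec} {β : Profile K} {n : ℕ} (hn : 1 ≤ n) :
    n ≤ alloc K b β ↔ n ≤ min b.n K ∧ ∀ j ∈ Finset.Icc 1 n, β.c j ≤ b.bid j := by
  unfold alloc
  rw [Finset.le_sup_iff (bot_lt_iff_ne_bot.mpr (Nat.one_le_iff_ne_zero.mp hn))]
  simp only [Finset.mem_filter, Finset.mem_Icc, id_eq]
  constructor
  · rintro ⟨r, ⟨⟨-, hr⟩, h⟩, hnr⟩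
    exact ⟨hnr.trans hr, fun j hj => h j ⟨hj.1, hj.2.trans hnr⟩⟩
  · rintro ⟨hr, h⟩
    exact ⟨n, ⟨⟨hn, hr⟩, h⟩, le_rfl⟩

theorem alloc_le_min (K : ℕ) (b : BidVec) (β : Profile K) : alloc K b β ≤ min b.n K := by
  rcases Nat.eq_zero_or_pos (alloc K b β) with h | h
  · exact h.le.trans (Nat.zero_le _)
  · exact ((le_alloc_iff h).mp le_rfl).1

theorem threshold_le_bid_alloc {K : ℕ} {b : BidVec} {β : Profile K} (h : 1 ≤ alloc K b β) :
    β.c (alloc K b β) ≤ b.bid (alloc K b β) :=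
  ((le_alloc_iff h).mp le_rfl).2 _ (Finset.mem_Icc.mpr ⟨h, le_rfl⟩)

theorem threshold_le_price {K : ℕ} {b : BidVec} {β : Profile K} (h : 1 ≤ alloc K b β) :
    β.c (alloc K b β) ≤ price K b β := by
  have hbid := threshold_le_bid_alloc h
  have hK : alloc K b β ≤ K := (alloc_le_min K b β).trans (min_le_right _ _)
  unfold price
  split_ifs with h0 hlt
  · omega
  · exact le_min hbid (β.mono _ _ h (Nat.le_succ _) hlt)
  · exact hbid.trans_eq (congrArg b.bid (le_antisymm hK (not_lt.mp hlt)))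

/-- The average cumulative valuation is non-increasing. -/
theorem ValidValuation.w_le_w {M : ℕ} {v : ℕ → ℝ} (hv : ValidValuation M v) {q r : ℕ}
    (hq : 1 ≤ q) (hqr : q ≤ r) (hr : r ≤ M) : w v r ≤ w v q := by
  have hq0 : (0 : ℝ) < q := by exact_mod_cast hq
  have hr0 : (0 : ℝ) < r := by exact_mod_cast hq.trans hqr
  have hsplit : ∑ j ∈ Finset.Icc 1 r, v j =
      ∑ j ∈ Finset.Icc 1 q, v j + ∑ j ∈ Finset.Ioc q r, v j := by
    rw [← Finset.sum_union]
    · congr 1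
      ext j
      simp only [Finset.mem_union, Finset.mem_Icc, Finset.mem_Ioc]
      omega
    · rw [Finset.disjoint_left]
      intro j
      simp only [Finset.mem_Icc, Finset.mem_Ioc]
      omega
  have hhead : (q : ℝ) * v q ≤ ∑ j ∈ Finset.Icc 1 q, v j := by
    have := Finset.card_nsmul_le_sum (Finset.Icc 1 q) v (v q) fun j hj =>
      hv.2 j q (Finset.mem_Icc.mp hj).1 (Finset.mem_Icc.mp hj).2 (hqr.trans hr)
    simpa using this
  have htail : ∑ j ∈ Finset.Ioc q r, v j ≤ ((r : ℝ) - q) * v q := by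
    have := Finset.sum_le_card_nsmul (Finset.Ioc q r) v (v q) fun j hj =>
      hv.2 q j hq (Finset.mem_Ioc.mp hj).1.le ((Finset.mem_Ioc.mp hj).2.trans hr)
    simpa [Nat.cast_sub hqr] using this
  have hqr' : (0 : ℝ) ≤ (r : ℝ) - q := sub_nonneg.mpr (by exact_mod_cast hqr)
  unfold w
  rw [div_le_div_iff₀ hr0 hq0, hsplit]
  nlinarith [mul_le_mul_of_nonneg_left hhead hqr', mul_le_mul_of_nonneg_left htail hq0.le]

theorem Feasible.price_le_w {v : ℕ → ℝ} {K : ℕ} {b : BidVec} {β : Profile K}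
    (hb : Feasible v K b β) (h : 1 ≤ alloc K b β) : price K b β ≤ w v (alloc K b β) :=
  (le_div_iff₀ (by exact_mod_cast h)).mpr hb

/-- Lemma `lem:approx1_multiple` (1): if the `m`-uniform strategy `b*`
satisfies the RoI constraint against `β` and is allocated `r` units, then for every
`1 ≤ q ≤ r` the 1-uniform safe strategy `(w q, q)` is allocated exactly `q` units. -/
theorem one_uniform_alloc_exact
    (K M : ℕ) (v : ℕ → ℝ) (hv : ValidValuation M v) (hMK : M ≤ K)
    (s : Uniform) (hs : s.IsUniform M) (β : Profile K)
    (hfeas : Feasible v K s.toBidVec β)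
    (q : ℕ) (hq1 : 1 ≤ q) (hqr : q ≤ alloc K s.toBidVec β) :
    alloc K (single (w v q) q).toBidVec β = q := by
  have hr1 := hq1.trans hqr
  have hmin := alloc_le_min K s.toBidVec β
  have hrK := hmin.trans (min_le_right _ _)
  have hrM : alloc K s.toBidVec β ≤ M := (hmin.trans (min_le_left _ _)).trans hs.2.2.2.2
  have hn : (single (w v q) q).toBidVec.n = q := by simp [Uniform.toBidVec, Uniform.Q, single]
  apply le_antisymm
  · exact (alloc_le_min _ _ _).trans ((min_le_left _ _).trans hn.le)
  · refine (le_alloc_iff hq1).mpr ⟨le_min hn.ge (hqr.trans hrK), fun j hj => ?_⟩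
    obtain ⟨hj1, hjq⟩ := Finset.mem_Icc.mp hj
    calc β.c j ≤ β.c (alloc K s.toBidVec β) := β.mono _ _ hj1 (hjq.trans hqr) hrK
      _ ≤ price K s.toBidVec β := threshold_le_price hr1
      _ ≤ w v (alloc K s.toBidVec β) := hfeas.price_le_w hr1
      _ ≤ w v q := hv.w_le_w hq1 hqr hrM

end Auction
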